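/- arXiv:0803.0132 — 2 statements merged into one kernel-verified Lean document; each statement's English description precedes it below -/
import Mathlib

section
/- There exist absolute constants 0 < c_1 < c_2 such that for every ε ∈ (0, 1/2) there is T_0 > 0 with the following property: for all T ≥ T_0, all G with T^ε ≤ G ≤ (1/2)√T, all distinct positive integers m ≠ n with m, n ≤ T G^{−2} log T, all U, V ∈ {0, G}, and all t ∈ [T, 2T], one has c_1 |√m − √n| / √T ≤ | 2 arsinh √(π m/(2(t+U))) − 2 arsinh √(π n/(2(t+V))) | ≤ c_2 |√m − √n| / √T, and also c_1 (√m + √n)/√T ≤ 2 arsinh √(π m/(2(t+U))) + 2 arsinh √(π n/(2(t+V))) ≤ c_2 (√m + √n)/√T. (Here 2 arsinh √(π n/(2t)) = ∂f(t,n)/∂t for f(t,n) := 2t·arsinh(√(π n/(2t))) + √(2π n t + π^2 n^2) − π/4.) -/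
open Real

lemma arsinh_sub_arsinh_bounds {x y : ℝ} (hy : 0 ≤ y) (hyx : y ≤ x) (hx : x ≤ 1) :
    (x - y) / 2 ≤ arsinh x - arsinh y ∧ arsinh x - arsinh y ≤ x - y := by
  have hd : ∀ z : ℝ, deriv arsinh z = (√(1 + z ^ 2))⁻¹ := fun z ↦ (hasDerivAt_arsinh z).deriv
  constructor
  · have h := (convex_Icc (0 : ℝ) 1).mul_sub_le_image_sub_of_le_deriv (f := arsinh) (C := 1 / 2)
      continuous_arsinh.continuousOn differentiable_arsinh.differentiableOn
      (fun z hz ↦ by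
        rw [interior_Icc] at hz
        rw [hd, one_div]
        apply inv_anti₀ (by positivity)
        rw [Real.sqrt_le_iff]
        constructor <;> nlinarith [hz.1, hz.2])
      y ⟨hy, hyx.trans hx⟩ x ⟨hy.trans hyx, hx⟩ hyx
    linarith
  · have h := (convex_Icc (0 : ℝ) 1).image_sub_le_mul_sub_of_deriv_le (f := arsinh) (C := 1)
      continuous_arsinh.continuousOn differentiable_arsinh.differentiableOn
      (fun z _ ↦ by
        rw [hd]
        apply inv_le_one_of_one_le₀
        rw [Real.one_le_sqrt]
        nlinarith [sq_nonneg z])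
      y ⟨hy, hyx.trans hx⟩ x ⟨hy.trans hyx, hx⟩ hyx
    linarith

lemma abs_arsinh_sub_arsinh_bounds {x y : ℝ} (hx₀ : 0 ≤ x) (hx : x ≤ 1) (hy₀ : 0 ≤ y)
    (hy : y ≤ 1) :
    |x - y| / 2 ≤ |arsinh x - arsinh y| ∧ |arsinh x - arsinh y| ≤ |x - y| := by
  wlog h : y ≤ x generalizing x y
  · rw [abs_sub_comm x, abs_sub_comm (arsinh x)]
    exact this hy₀ hy hx₀ hx (le_of_not_ge h)
  rw [abs_of_nonneg (sub_nonneg.2 h), abs_of_nonneg (sub_nonneg.2 (arsinh_le_arsinh.2 h))]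
  exact arsinh_sub_arsinh_bounds hy₀ h hx

lemma sqrt_pi_mul_div_bounds {m T u : ℝ} (hm : 0 ≤ m) (hT : 0 < T) (hTu : T ≤ u)
    (huT : u ≤ 3 * T) :
    √m / (2 * √T) ≤ √(π * m / (2 * u)) ∧ √(π * m / (2 * u)) ≤ 2 * √m / √T := by
  have hu : 0 < u := hT.trans_le hTu
  constructor
  · apply Real.le_sqrt_of_sq_le
    rw [div_pow, mul_pow, Real.sq_sqrt hm, Real.sq_sqrt hT.le,
      div_le_div_iff₀ (by positivity) (by positivity)]
    nlinarith [mul_le_mul_of_nonneg_left huT hm,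
      mul_le_mul_of_nonneg_right pi_gt_three.le (mul_nonneg hm hT.le)]
  · rw [Real.sqrt_le_iff]
    refine ⟨by positivity, ?_⟩
    rw [div_pow, mul_pow, Real.sq_sqrt hm, Real.sq_sqrt hT.le,
      div_le_div_iff₀ (by positivity) (by positivity)]
    nlinarith [mul_le_mul_of_nonneg_left hTu hm,
      mul_le_mul_of_nonneg_right pi_le_four (mul_nonneg hm hT.le), mul_nonneg hm hT.le]

lemma abs_pi_mul_div_sub_bounds {m n T G t U V : ℝ} (hT : 0 < T) (hm : 0 ≤ m) (hn : 0 ≤ n)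
    (hmn : 1 ≤ |m - n|) (hmG : m * G ≤ T / 100) (hnG : n * G ≤ T / 100)
    (hG : G ≤ T / 2) (hU : 0 ≤ U) (hUG : U ≤ G) (hV : 0 ≤ V) (hVG : V ≤ G)
    (hTt : T ≤ t) (htT : t ≤ 2 * T) :
    |m - n| / (4 * T) ≤ |π * m / (2 * (t + U)) - π * n / (2 * (t + V))| ∧
      |π * m / (2 * (t + U)) - π * n / (2 * (t + V))| ≤ 4 * |m - n| / T := by
  have ht : 0 < t := hT.trans_le hTt
  have htU : 0 < t + U := by linarith
  have htV : 0 < t + V := by linarith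
  have hEq : π * m / (2 * (t + U)) - π * n / (2 * (t + V)) =
      π * ((m - n) * t + (m * V - n * U)) / (2 * ((t + U) * (t + V))) := by
    field_simp
    ring
  have hmV : m * V ≤ T / 100 := (mul_le_mul_of_nonneg_left hVG hm).trans hmG
  have hnU : n * U ≤ T / 100 := (mul_le_mul_of_nonneg_left hUG hn).trans hnG
  have hcross : |m * V - n * U| ≤ T / 100 :=
    abs_le.2 ⟨by linarith [mul_nonneg hm hV], by linarith [mul_nonneg hn hU]⟩
  have hmain : |(m - n) * t| = |m - n| * t := by rw [abs_mul, abs_of_pos ht]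
  have hT_le : T ≤ |m - n| * t := by nlinarith
  have hup := abs_add_le ((m - n) * t) (m * V - n * U)
  have hlo := abs_sub_abs_le_abs_add ((m - n) * t) (m * V - n * U)
  rw [hmain] at hup hlo
  rw [hEq, abs_div, abs_mul, abs_of_pos pi_pos,
    abs_of_pos (show 0 < 2 * ((t + U) * (t + V)) by positivity)]
  set X := |(m - n) * t + (m * V - n * U)|
  set D := |m - n|
  have hX : 0 ≤ X := abs_nonneg _
  have hD : 0 ≤ D := abs_nonneg _
  have hXlo : 99 / 100 * (D * t) ≤ X := by linarith
  have hXup : X ≤ 101 / 100 * (D * t) := by linarith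
  have hprod_lo : t * t ≤ (t + U) * (t + V) := by gcongr <;> linarith
  have hprod_up : (t + U) * (t + V) ≤ (3 / 2 * t) * (3 / 2 * t) := by gcongr <;> linarith
  constructor
  · rw [div_le_div_iff₀ (by positivity) (by positivity)]
    calc D * (2 * ((t + U) * (t + V))) ≤ D * (2 * ((3 / 2 * t) * (3 / 2 * t))) := by gcongr
      _ = (9 / 2) * (D * t) * t := by ring
      _ ≤ (9 / 2) * (D * t) * (2 * T) := by gcongr
      _ ≤ 3 * (99 / 100 * (D * t)) * (4 * T) := by
        nlinarith [mul_nonneg (mul_nonneg hD ht.le) hT.le]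
      _ ≤ π * X * (4 * T) := by
        gcongr
        exact pi_gt_three.le
  · rw [div_le_div_iff₀ (by positivity) (by positivity)]
    calc π * X * T ≤ 4 * (101 / 100 * (D * t)) * t := by
          gcongr
          exact pi_le_four
      _ ≤ 4 * D * (2 * (t * t)) := by nlinarith [mul_nonneg (mul_nonneg hD ht.le) ht.le]
      _ ≤ 4 * D * (2 * ((t + U) * (t + V))) := by gcongr

lemma abs_sqrt_sub_sqrt_mul_add {x y : ℝ} (hx : 0 ≤ x) (hy : 0 ≤ y) :
    |√x - √y| * (√x + √y) = |x - y| := by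
  have h : 0 ≤ √x + √y := by positivity
  rw [← abs_of_nonneg h, ← abs_mul]
  congr 1
  linear_combination Real.sq_sqrt hx - Real.sq_sqrt hy

lemma arsinh_sqrt_bounds {m n T G t U V : ℝ} (hT : 0 < T) (hm : 0 < m) (hn : 0 < n)
    (hmn : 1 ≤ |m - n|) (hmT : m ≤ T / 100) (hnT : n ≤ T / 100)
    (hmG : m * G ≤ T / 100) (hnG : n * G ≤ T / 100)
    (hG : G ≤ T / 2) (hU : 0 ≤ U) (hUG : U ≤ G) (hV : 0 ≤ V) (hVG : V ≤ G)
    (hTt : T ≤ t) (htT : t ≤ 2 * T) :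
    (1 / 8 * |√m - √n| / √T ≤
        |2 * arsinh √(π * m / (2 * (t + U))) - 2 * arsinh √(π * n / (2 * (t + V)))| ∧
      |2 * arsinh √(π * m / (2 * (t + U))) - 2 * arsinh √(π * n / (2 * (t + V)))| ≤
        16 * |√m - √n| / √T) ∧
    (1 / 8 * (√m + √n) / √T ≤
        2 * arsinh √(π * m / (2 * (t + U))) + 2 * arsinh √(π * n / (2 * (t + V))) ∧
      2 * arsinh √(π * m / (2 * (t + U))) + 2 * arsinh √(π * n / (2 * (t + V))) ≤
        16 * (√m + √n) / √T) := by
  have htU : 0 < t + U := by linarith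
  have htV : 0 < t + V := by linarith
  obtain ⟨ha_lo, ha_up⟩ := sqrt_pi_mul_div_bounds (u := t + U) hm.le hT (by linarith) (by linarith)
  obtain ⟨hb_lo, hb_up⟩ := sqrt_pi_mul_div_bounds (u := t + V) hn.le hT (by linarith) (by linarith)
  obtain ⟨hd_lo, hd_up⟩ :=
    abs_pi_mul_div_sub_bounds hT hm.le hn.le hmn hmG hnG hG hU hUG hV hVG hTt htT
  have hab := abs_sqrt_sub_sqrt_mul_add (x := π * m / (2 * (t + U)))
    (y := π * n / (2 * (t + V))) (by positivity) (by positivity)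
  have hpq := abs_sqrt_sub_sqrt_mul_add hm.le hn.le
  rw [← hab, ← hpq] at hd_lo hd_up
  have le_one : ∀ k : ℝ, 0 ≤ k → k ≤ T / 100 → 2 * √k / √T ≤ 1 := by
    intro k hk hkT
    rw [div_le_one (by positivity)]
    apply Real.le_sqrt_of_sq_le
    rw [mul_pow, Real.sq_sqrt hk]
    linarith
  have ha₁ := ha_up.trans (le_one m hm.le hmT)
  have hb₁ := hb_up.trans (le_one n hn.le hnT)
  set a := √(π * m / (2 * (t + U)))
  set b := √(π * n / (2 * (t + V)))
  have ha₀ : 0 ≤ a := Real.sqrt_nonneg _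
  have hb₀ : 0 ≤ b := Real.sqrt_nonneg _
  have hs : 0 < √m + √n := by positivity
  have hr : 0 < √T := by positivity
  have hTr : T = √T * √T := (Real.mul_self_sqrt hT.le).symm
  have hs_lo : (√m + √n) / (2 * √T) ≤ a + b := by rw [add_div]; linarith
  have hs_up : a + b ≤ 2 * (√m + √n) / √T := by rw [mul_add, add_div]; linarith
  have hdiff_lo : |√m - √n| / (8 * √T) ≤ |a - b| := by
    have h := hd_lo.trans (mul_le_mul_of_nonneg_left hs_up (abs_nonneg (a - b)))
    rw [hTr, Real.sqrt_mul_self hr.le] at h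
    rw [← mul_le_mul_iff_left₀ (show 0 < 2 * (√m + √n) / √T by positivity)]
    refine le_trans (le_of_eq ?_) h
    field_simp
    ring
  have hdiff_up : |a - b| ≤ 8 * |√m - √n| / √T := by
    have h := (mul_le_mul_of_nonneg_left hs_lo (abs_nonneg (a - b))).trans hd_up
    rw [hTr, Real.sqrt_mul_self hr.le] at h
    rw [← mul_le_mul_iff_left₀ (show 0 < (√m + √n) / (2 * √T) by positivity)]
    refine h.trans (le_of_eq ?_)
    field_simp
    ring
  obtain ⟨h_lo, h_up⟩ := abs_arsinh_sub_arsinh_bounds ha₀ ha₁ hb₀ hb₁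
  obtain ⟨hA_lo, hA_up⟩ := arsinh_sub_arsinh_bounds le_rfl ha₀ ha₁
  obtain ⟨hB_lo, hB_up⟩ := arsinh_sub_arsinh_bounds le_rfl hb₀ hb₁
  rw [arsinh_zero, sub_zero, sub_zero] at hA_lo hA_up hB_lo hB_up
  rw [← mul_sub, abs_mul, abs_two]
  have hq : 0 ≤ (√m + √n) / √T := by positivity
  rw [mul_comm (2 : ℝ) √T, ← div_div] at hs_lo
  rw [mul_comm (8 : ℝ) √T, ← div_div] at hdiff_lo
  rw [mul_div_assoc] at hs_up hdiff_up
  simp only [mul_div_assoc]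
  refine ⟨⟨?_, ?_⟩, ?_, ?_⟩ <;> linarith

lemma one_le_abs_natCast_sub {m n : ℕ} (h : m ≠ n) : (1 : ℝ) ≤ |(m : ℝ) - n| := by
  have := Int.one_le_abs (sub_ne_zero.2 (Nat.cast_injective.ne h : (m : ℤ) ≠ n))
  exact_mod_cast this

theorem stmt_8 :
    ∃ c₁ c₂ : ℝ, 0 < c₁ ∧ c₁ < c₂ ∧
      ∀ ε : ℝ, 0 < ε → ε < 1 / 2 →
        ∃ T₀ > (0 : ℝ), ∀ T ≥ T₀, ∀ G : ℝ,
          T ^ ε ≤ G → G ≤ (1 / 2) * Real.sqrt T →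
          ∀ m n : ℕ, m ≠ n → 1 ≤ m → 1 ≤ n →
            (m : ℝ) ≤ T * G ^ (-(2 : ℝ)) * Real.log T →
            (n : ℝ) ≤ T * G ^ (-(2 : ℝ)) * Real.log T →
            ∀ U V : ℝ, U ∈ ({0, G} : Set ℝ) → V ∈ ({0, G} : Set ℝ) →
            ∀ t ∈ Set.Icc T (2 * T),
              (c₁ * |Real.sqrt m - Real.sqrt n| / Real.sqrt T ≤
                  |2 * Real.arsinh (Real.sqrt (π * m / (2 * (t + U)))) -
                    2 * Real.arsinh (Real.sqrt (π * n / (2 * (t + V))))| ∧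
                |2 * Real.arsinh (Real.sqrt (π * m / (2 * (t + U)))) -
                    2 * Real.arsinh (Real.sqrt (π * n / (2 * (t + V))))| ≤
                  c₂ * |Real.sqrt m - Real.sqrt n| / Real.sqrt T) ∧
              (c₁ * (Real.sqrt m + Real.sqrt n) / Real.sqrt T ≤
                  2 * Real.arsinh (Real.sqrt (π * m / (2 * (t + U)))) +
                    2 * Real.arsinh (Real.sqrt (π * n / (2 * (t + V)))) ∧
                2 * Real.arsinh (Real.sqrt (π * m / (2 * (t + U)))) +
                    2 * Real.arsinh (Real.sqrt (π * n / (2 * (t + V)))) ≤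
                  c₂ * (Real.sqrt m + Real.sqrt n) / Real.sqrt T) := by
  refine ⟨1 / 8, 16, by norm_num, by norm_num, fun ε hε _ ↦ ?_⟩
  obtain ⟨T₁, hT₁⟩ := Filter.eventually_atTop.1
    ((isLittleO_log_rpow_atTop hε).bound (show (0 : ℝ) < 1 / 100 by norm_num))
  refine ⟨max T₁ 1, by positivity, fun T hT G hTG hGT m n hmn hm hn hmN hnN U V hU hV t ht ↦ ?_⟩
  have hT1 : 1 ≤ T := (le_max_right _ _).trans hT
  have hT0 : 0 < T := by linarith
  have hG1 : 1 ≤ G := (Real.one_le_rpow hT1 hε.le).trans hTG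
  have hG0 : 0 < G := by linarith
  have hlog : Real.log T ≤ G / 100 := by
    have h := hT₁ T ((le_max_left _ _).trans hT)
    rw [Real.norm_eq_abs, Real.norm_eq_abs, abs_of_pos (Real.rpow_pos_of_pos hT0 ε)] at h
    linarith [le_abs_self (Real.log T)]
  have hG_half : G ≤ T / 2 := by
    have : √T ≤ T := Real.sqrt_le_iff.2 ⟨hT0.le, by nlinarith⟩
    linarith
  have hmul : ∀ k : ℝ, k ≤ T * G ^ (-(2 : ℝ)) * Real.log T → k * G ≤ T / 100 := by
    intro k hk
    rw [Real.rpow_neg hG0.le, Real.rpow_two] at hk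
    calc k * G ≤ T * (G ^ 2)⁻¹ * (G / 100) * G := by
          gcongr
          exact hk.trans (by gcongr)
      _ = T / 100 := by field_simp
  have hle : ∀ k : ℝ, 0 ≤ k → k * G ≤ T / 100 → k ≤ T / 100 := fun k hk h ↦
    (le_mul_of_one_le_right hk hG1).trans h
  have hmem : ∀ W ∈ ({0, G} : Set ℝ), 0 ≤ W ∧ W ≤ G := by
    rintro W (rfl | rfl)
    · exact ⟨le_rfl, hG0.le⟩
    · exact ⟨hG0.le, le_rfl⟩
  have hmG := hmul m hmN
  have hnG := hmul n hnN
  exact arsinh_sqrt_bounds hT0 (by exact_mod_cast hm) (by exact_mod_cast hn)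
    (one_le_abs_natCast_sub hmn) (hle m (by positivity) hmG) (hle n (by positivity) hnG)
    hmG hnG hG_half (hmem U hU).1 (hmem U hU).2 (hmem V hV).1 (hmem V hV).2 ht.1 ht.2
end

section
/- For every ε ∈ (0, 1/2) there exist C > 0 and T_0 > 0 such that for all T ≥ T_0, all G with T^ε ≤ G ≤ (1/2)√T, all integers n with 1 ≤ n ≤ T G^{−2} log T, and all t ∈ [T, 2T], one has | sin^2( (f(t+G, n) − f(t, n))/2 ) − sin^2( √(π n/(2t)) · G ) | ≤ C ( G^2 n^{1/2} + G n^{3/2} ) T^{−3/2}. -/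
open Real

/-- The Atkinson phase `f(t, n)`. -/
noncomputable def atkF (t : ℝ) (n : ℕ) : ℝ :=
  2 * t * Real.arsinh (Real.sqrt (π * n / (2 * t))) +
    Real.sqrt (2 * π * n * t + π ^ 2 * n ^ 2) - π / 4

theorem self_sub_cube_le_arsinh {x : ℝ} (hx : 0 ≤ x) : x - x ^ 3 ≤ Real.arsinh x := by
  have hd (y : ℝ) : HasDerivAt (fun y : ℝ => Real.arsinh y - (y - y ^ 3))
      ((√(1 + y ^ 2))⁻¹ - (1 - 3 * y ^ 2)) y := by
    have h := (Real.hasDerivAt_arsinh y).sub ((hasDerivAt_id y).sub (hasDerivAt_pow 3 y))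
    norm_num at h
    exact h
  have hmono : Monotone fun y : ℝ => Real.arsinh y - (y - y ^ 3) := by
    refine monotone_of_hasDerivAt_nonneg hd fun y => ?_
    have hs : √(1 + y ^ 2) ≤ 1 + y ^ 2 :=
      Real.sqrt_le_iff.2 ⟨by positivity, by nlinarith [sq_nonneg y, sq_nonneg (y ^ 2)]⟩
    have hinv : (1 + y ^ 2)⁻¹ ≤ (√(1 + y ^ 2))⁻¹ := inv_anti₀ (by positivity) hs
    have hlow : 1 - 3 * y ^ 2 ≤ (1 + y ^ 2)⁻¹ := by
      rw [inv_eq_one_div, le_div_iff₀ (by positivity)]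
      nlinarith [sq_nonneg y, sq_nonneg (y ^ 2)]
    simpa using hlow.trans hinv
  simpa using hmono hx

theorem arsinh_le_self {x : ℝ} (hx : 0 ≤ x) : Real.arsinh x ≤ x := by
  simpa using Real.self_le_sinh_iff.2 (Real.arsinh_nonneg_iff.2 hx)

theorem abs_sin_sq_sub_sin_sq_le (a b : ℝ) :
    |Real.sin a ^ 2 - Real.sin b ^ 2| ≤ |a - b| := by
  have h : Real.sin a ^ 2 - Real.sin b ^ 2 = Real.sin (a + b) * Real.sin (a - b) := by
    rw [Real.sin_add, Real.sin_sub]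
    linear_combination Real.sin b ^ 2 * Real.sin_sq_add_cos_sq a -
      Real.sin a ^ 2 * Real.sin_sq_add_cos_sq b
  rw [h, abs_mul]
  calc |Real.sin (a + b)| * |Real.sin (a - b)| ≤ 1 * |a - b| :=
        mul_le_mul (Real.abs_sin_le_one _) Real.abs_sin_le_abs (abs_nonneg _) zero_le_one
    _ = |a - b| := one_mul _

theorem hasDerivAt_atkF {t : ℝ} (ht : 0 < t) {n : ℕ} (hn : 1 ≤ n) :
    HasDerivAt (fun t => atkF t n) (2 * Real.arsinh √(π * n / (2 * t))) t := by
  have hn0 : (0 : ℝ) < n := by exact_mod_cast hn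
  have hπ := Real.pi_pos
  have hq : 0 < π * n / (2 * t) := by positivity
  have hr : 0 < 2 * π * n * t + π ^ 2 * n ^ 2 := by positivity
  have h1 : HasDerivAt (fun t : ℝ => π * n / (2 * t)) (-(π * n / (2 * t)) / t) t := by
    have := (hasDerivAt_const t (π * n)).div ((hasDerivAt_id t).const_mul 2) (by simp [ht.ne'])
    refine this.congr_deriv ?_
    simp only [id_eq]
    field_simp
    ring
  have h2 := ((hasDerivAt_id t).const_mul 2).mul (h1.sqrt hq.ne').arsinh
  have h3 : HasDerivAt (fun t : ℝ => 2 * π * n * t + π ^ 2 * n ^ 2) (2 * π * n) t := by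
    simpa using ((hasDerivAt_id t).const_mul (2 * π * n)).add_const (π ^ 2 * (n : ℝ) ^ 2)
  have h4 := (h2.add (h3.sqrt hr.ne')).sub_const (π / 4)
  refine h4.congr_deriv ?_
  set x := √(π * n / (2 * t))
  have hx : 0 < x := Real.sqrt_pos.2 hq
  have hx2 : x ^ 2 = π * n / (2 * t) := Real.sq_sqrt hq.le
  have hpn : π * n = 2 * t * x ^ 2 := by rw [hx2]; field_simp
  set w := √(1 + x ^ 2)
  have hw : 0 < w := Real.sqrt_pos.2 (by positivity)
  have hw2 : w ^ 2 = 1 + x ^ 2 := Real.sq_sqrt (by positivity)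
  have hroot : √(2 * π * n * t + π ^ 2 * n ^ 2) = 2 * t * x * w := by
    rw [Real.sqrt_eq_iff_eq_sq hr.le (by positivity)]
    linear_combination (2 * t + π * n + 2 * t * x ^ 2) * hpn - 4 * t ^ 2 * x ^ 2 * hw2
  rw [hroot, ← hx2]
  have h5 : 2 * π * n = 4 * t * x ^ 2 := by linear_combination 2 * hpn
  rw [h5]
  simp
  field_simp
  ring

theorem stmt_10 :
    ∀ ε : ℝ, 0 < ε → ε < 1 / 2 →
      ∃ C > (0 : ℝ), ∃ T₀ > (0 : ℝ), ∀ T ≥ T₀, ∀ G : ℝ,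
        T ^ ε ≤ G → G ≤ (1 / 2) * Real.sqrt T →
        ∀ n : ℕ, 1 ≤ n → (n : ℝ) ≤ T * G ^ (-(2 : ℝ)) * Real.log T →
        ∀ t ∈ Set.Icc T (2 * T),
          |Real.sin ((atkF (t + G) n - atkF t n) / 2) ^ 2 -
              Real.sin (Real.sqrt (π * n / (2 * t)) * G) ^ 2| ≤
            C * (G ^ 2 * (n : ℝ) ^ ((1 : ℝ) / 2) + G * (n : ℝ) ^ ((3 : ℝ) / 2)) *
              T ^ (-(3 : ℝ) / 2) := by
  intro ε _ _
  refine ⟨8, by norm_num, 1, one_pos, fun T hT G hG _ n hn _ t ht => ?_⟩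
  have hT0 : 0 < T := one_pos.trans_le hT
  have hG0 : 0 < G := (Real.rpow_pos_of_pos hT0 ε).trans_le hG
  have ht0 : 0 < t := hT0.trans_le ht.1
  have hn0 : (0 : ℝ) < n := by exact_mod_cast hn
  have hπ := Real.pi_pos
  refine (abs_sin_sq_sub_sin_sq_le _ _).trans ?_
  obtain ⟨ξ, hξ, hmv⟩ := exists_hasDerivAt_eq_slope (fun t => atkF t n)
    (fun t => 2 * Real.arsinh √(π * n / (2 * t))) (lt_add_of_pos_right t hG0)
    (fun s hs => (hasDerivAt_atkF (ht0.trans_le hs.1) hn).continuousAt.continuousWithinAt)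
    (fun s hs => hasDerivAt_atkF (ht0.trans hs.1) hn)
  have hξ0 : 0 < ξ := ht0.trans hξ.1
  set x := √(π * n / (2 * t))
  set y := √(π * n / (2 * ξ))
  have hx : 0 < x := Real.sqrt_pos.2 (by positivity)
  have hy : 0 < y := Real.sqrt_pos.2 (by positivity)
  have hx2 : x ^ 2 = π * n / (2 * t) := Real.sq_sqrt (by positivity)
  have hy2 : y ^ 2 = π * n / (2 * ξ) := Real.sq_sqrt (by positivity)
  have hyx : y ≤ x := Real.sqrt_le_sqrt (by gcongr; exact hξ.1.le)
  have hcross : x ^ 2 * t = y ^ 2 * ξ := by rw [hx2, hy2]; field_simp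
  have hdiff : x - y ≤ x * G / T := by
    rw [le_div_iff₀ hT0]
    have h1 : (x - y) * t ≤ x * G := by
      have h2 : (x ^ 2 - y ^ 2) * t ≤ x ^ 2 * G := by
        have h3 : y ^ 2 * (ξ - t) ≤ x ^ 2 * G := by
          gcongr
          · linarith [hξ.1]
          · linarith [hξ.2]
        linarith
      have h4 : (x - y) * x * t ≤ (x ^ 2 - y ^ 2) * t := by
        gcongr
        nlinarith
      nlinarith
    exact (mul_le_mul_of_nonneg_left ht.1 (sub_nonneg.2 hyx)).trans h1
  have hphase : (atkF (t + G) n - atkF t n) / 2 = Real.arsinh y * G := by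
    rw [add_sub_cancel_left, eq_div_iff hG0.ne'] at hmv
    linarith
  have hy3 : y ^ 3 ≤ x ^ 3 := by gcongr
  have hclose : |Real.arsinh y - x| ≤ x * G / T + x ^ 3 := by
    rw [abs_le]
    constructor
    · linarith [self_sub_cube_le_arsinh hy.le]
    · have : 0 ≤ x * G / T + x ^ 3 := by positivity
      linarith [arsinh_le_self hy.le]
  set p := √(n : ℝ) with hp
  set q := (√T)⁻¹ with hq
  have hp0 : 0 ≤ p := Real.sqrt_nonneg _
  have hq0 : 0 ≤ q := by positivity
  have hq2 : q ^ 2 = T⁻¹ := by rw [hq, inv_pow, Real.sq_sqrt hT0.le]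
  have hxpq : x ≤ 2 * p * q := by
    refine Real.sqrt_le_iff.2 ⟨by positivity, ?_⟩
    rw [mul_pow, mul_pow, hq2, hp, Real.sq_sqrt hn0.le, ← div_eq_mul_inv,
      div_le_div_iff₀ (by positivity) hT0]
    have : π * n * T ≤ 4 * n * t := by
      gcongr
      · exact Real.pi_le_four
      · exact ht.1
    nlinarith [mul_pos hn0 ht0]
  have hn1 : (n : ℝ) ^ ((1 : ℝ) / 2) = p := (Real.sqrt_eq_rpow _).symm
  have hn3 : (n : ℝ) ^ ((3 : ℝ) / 2) = p ^ 3 := by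
    rw [← hn1, ← Real.rpow_mul_natCast hn0.le]
    norm_num
  have hT3 : T ^ (-(3 : ℝ) / 2) = q ^ 3 := by
    rw [hq, Real.sqrt_eq_rpow, ← Real.rpow_neg hT0.le, ← Real.rpow_mul_natCast hT0.le]
    norm_num
  rw [hphase, ← sub_mul, abs_mul, abs_of_pos hG0, hn1, hn3, hT3]
  calc |Real.arsinh y - x| * G ≤ (x * G / T + x ^ 3) * G := by gcongr
    _ = (x * G * q ^ 2 + x ^ 3) * G := by rw [hq2, div_eq_mul_inv]
    _ ≤ (2 * p * q * G * q ^ 2 + (2 * p * q) ^ 3) * G := by gcongr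
    _ = 8 * (G ^ 2 * p + G * p ^ 3) * q ^ 3 - 6 * (G ^ 2 * p * q ^ 3) := by ring
    _ ≤ 8 * (G ^ 2 * p + G * p ^ 3) * q ^ 3 := sub_le_self _ (by positivity)
end
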